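/- arXiv:1210.4533 — 3 statements merged into one kernel-verified Lean document; each statement's English description precedes it below -/
import Mathlib

section
/- Let H be a complex Hilbert space and let A, B be C*-subalgebras of B(H) with d(A,B) < γ for some γ > 0. Then for every positive contraction a ∈ A there exists a positive contraction b ∈ B with ‖a−b‖ < 2γ. -/
open Filter Topology Metric ComplexOrder

variable {H : Type*} [NormedAddCommGroup H] [InnerProductSpace ℂ H] [CompleteSpace H]

/-- The Kadison–Kastler distance between two subsets of a C*-algebra: the Hausdorff
distance between their closed unit balls. -/
noncomputable def KKdist {E : Type*} [NormedAddCommGroup E] (S T : Set E) : ℝ :=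
  hausdorffDist (S ∩ closedBall 0 1) (T ∩ closedBall 0 1)

/-- A subalgebra of `B(H)` acts nondegenerately if the closed linear span of
`{a ξ : a ∈ A, ξ ∈ H}` is all of `H`. -/
def Nondegenerate (A : NonUnitalStarSubalgebra ℂ (H →L[ℂ] H)) : Prop :=
  Dense (↑(Submodule.span ℂ {v : H | ∃ a ∈ A, ∃ ξ : H, v = a ξ}) : Set H)

/-- The operator on the `n`-fold Hilbert space direct sum `Hⁿ` given by an `n × n`
matrix of operators on `H`. -/
noncomputable def matrixOp {n : ℕ} (a : Fin n → Fin n → (H →L[ℂ] H)) :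
    (PiLp 2 fun _ : Fin n => H) →L[ℂ] (PiLp 2 fun _ : Fin n => H) :=
  ((PiLp.continuousLinearEquiv 2 ℂ (fun _ : Fin n => H)).symm :
      (∀ _ : Fin n, H) →L[ℂ] PiLp 2 fun _ : Fin n => H).comp
    ((ContinuousLinearMap.pi fun i => ∑ j, (a i j).comp (ContinuousLinearMap.proj j)).comp
      ((PiLp.continuousLinearEquiv 2 ℂ (fun _ : Fin n => H) :
        (PiLp 2 fun _ : Fin n => H) →L[ℂ] ∀ _ : Fin n, H)))

/-- `Mₙ(A)`: the `n × n` matrices with entries in `A`, acting on `Hⁿ`. -/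
noncomputable def MatrixAmp (n : ℕ) (A : NonUnitalStarSubalgebra ℂ (H →L[ℂ] H)) :
    Set ((PiLp 2 fun _ : Fin n => H) →L[ℂ] (PiLp 2 fun _ : Fin n => H)) :=
  {T | ∃ a : Fin n → Fin n → (H →L[ℂ] H), (∀ i j, a i j ∈ A) ∧ T = matrixOp a}

/-- Christensen's property `D_k`: for every nondegenerate representation `π` of `A` on a
Hilbert space `K` and every `T ∈ B(K)`, the distance from `T` to the commutant `π(A)'`
is at most `k · sup{‖π(a) T − T π(a)‖ : a ∈ A, ‖a‖ ≤ 1}`. -/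
def PropertyDk (k : ℝ) (A : NonUnitalStarSubalgebra ℂ (H →L[ℂ] H)) : Prop :=
  ∀ (K : Type*) [NormedAddCommGroup K] [InnerProductSpace ℂ K] [CompleteSpace K]
    (π : A →⋆ₙₐ[ℂ] (K →L[ℂ] K)),
    Dense (↑(Submodule.span ℂ {v : K | ∃ (a : A) (ξ : K), v = π a ξ}) : Set K) →
    ∀ T : K →L[ℂ] K,
      infDist T {S : K →L[ℂ] K | ∀ a : A, π a * S = S * π a} ≤
        k * sSup {r : ℝ | ∃ a : A, ‖(a : H →L[ℂ] H)‖ ≤ 1 ∧ r = ‖π a * T - T * π a‖}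

/-- The commutant of a set of operators. -/
def commutantSet {E : Type*} [Mul E] (S : Set E) : Set E := {T | ∀ a ∈ S, a * T = T * a}

/-- Cuntz subequivalence `a ≾ b` relative to a subset `S` (a C*-subalgebra as a set):
there is a sequence `(vₙ)` in `S` with `‖vₙ b vₙ* − a‖ → 0`. -/
def CuntzBelowIn (S : Set (H →L[ℂ] H)) (a b : H →L[ℂ] H) : Prop :=
  ∃ v : ℕ → H →L[ℂ] H, (∀ n, v n ∈ S) ∧
    Tendsto (fun n => ‖v n * b * star (v n) - a‖) atTop (𝓝 0)

/-- `(a − ε)₊` via the continuous functional calculus. -/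
noncomputable def cutP (a : H →L[ℂ] H) (ε : ℝ) : H →L[ℂ] H :=
  cfc (fun t : ℝ => max (t - ε) 0) a

/-- Rapidly increasing sequence in the C*-subalgebra given by the set `S`. -/
def RapidlyIncreasingIn (S : Set (H →L[ℂ] H)) (a : ℕ → H →L[ℂ] H) : Prop :=
  ∀ n, ∃ ε > (0 : ℝ), CuntzBelowIn S (a n) (cutP (a (n + 1)) ε)

/-- Very rapidly increasing sequence in the C*-subalgebra given by the set `S`. -/
def VeryRapidlyIncreasingIn (S : Set (H →L[ℂ] H)) (a : ℕ → H →L[ℂ] H) : Prop :=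
  RapidlyIncreasingIn S a ∧
    ∀ ε > (0 : ℝ), ∀ n, ∃ m₀, ∀ m ≥ m₀,
      ∃ v ∈ S, ‖v‖ ≤ 1 ∧ ‖v * a m * star v * a n - a n‖ < ε

/-- A bounded trace on the C*-subalgebra `A`: a bounded (equivalently continuous) linear
functional `τ` with `τ(x*x) = τ(xx*) ≥ 0` for all `x`. -/
def IsBoundedTrace (A : NonUnitalStarSubalgebra ℂ (H →L[ℂ] H)) (τ : A → ℂ) : Prop :=
  (∀ x y : A, τ (x + y) = τ x + τ y) ∧ (∀ (c : ℂ) (x : A), τ (c • x) = c * τ x) ∧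
    (∀ x : A, τ (star x * x) = τ (x * star x)) ∧ (∀ x : A, 0 ≤ τ (star x * x)) ∧
    (∃ C : ℝ, ∀ x : A, ‖τ x‖ ≤ C * ‖(x : H →L[ℂ] H)‖)

theorem stmt0 (A B : NonUnitalStarSubalgebra ℂ (H →L[ℂ] H))
    (hAc : IsClosed (A : Set (H →L[ℂ] H))) (hBc : IsClosed (B : Set (H →L[ℂ] H)))
    (γ : ℝ) (hγ : 0 < γ) (hd : KKdist (A : Set (H →L[ℂ] H)) (B : Set (H →L[ℂ] H)) < γ)
    (a : H →L[ℂ] H) (haA : a ∈ A) (ha : 0 ≤ a) (ha1 : ‖a‖ ≤ 1) :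
    ∃ b ∈ B, 0 ≤ b ∧ ‖b‖ ≤ 1 ∧ ‖a - b‖ < 2 * γ := by
  have hxA : CFC.sqrt a ∈ A := by
    rw [CFC.sqrt_eq_real_sqrt a ha]
    exact cfcₙ_mem (𝕜 := ℝ) (𝕜' := ℂ) (hs := hAc) Real.sqrt haA
  have hx0 : 0 ≤ CFC.sqrt a := CFC.sqrt_nonneg a
  have hxx : CFC.sqrt a * CFC.sqrt a = a := CFC.sqrt_mul_sqrt_self a ha
  generalize CFC.sqrt a = x at hxA hx0 hxx
  have hsx : star x = x := (IsSelfAdjoint.of_nonneg hx0).star_eq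
  have hx1 : ‖x‖ ≤ 1 := by
    have h : ‖star x * x‖ = ‖x‖ * ‖x‖ := CStarRing.norm_star_mul_self
    rw [hsx, hxx] at h
    nlinarith [norm_nonneg x]
  have hfin : hausdorffEDist ((A : Set (H →L[ℂ] H)) ∩ closedBall 0 1)
      ((B : Set (H →L[ℂ] H)) ∩ closedBall 0 1) ≠ ⊤ :=
    hausdorffEDist_ne_top_of_nonempty_of_bounded
      ⟨0, A.zero_mem, by simp⟩ ⟨0, B.zero_mem, by simp⟩
      (isBounded_closedBall.subset Set.inter_subset_right)
      (isBounded_closedBall.subset Set.inter_subset_right)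
  obtain ⟨y, ⟨hyB, hy1⟩, hxy⟩ := exists_dist_lt_of_hausdorffDist_lt
    (show x ∈ (A : Set (H →L[ℂ] H)) ∩ closedBall 0 1 from ⟨hxA, by simpa using hx1⟩) hd hfin
  have hy1 : ‖y‖ ≤ 1 := by simpa using hy1
  rw [dist_eq_norm] at hxy
  refine ⟨star y * y, mul_mem (star_mem hyB) hyB, star_mul_self_nonneg y, ?_, ?_⟩
  · rw [CStarRing.norm_star_mul_self]
    nlinarith [norm_nonneg y]
  · have e : a - star y * y = x * (x - y) + star (x - y) * y := by
      rw [star_sub, hsx, ← hxx]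
      noncomm_ring
    rw [e]
    have h1 := norm_mul_le x (x - y)
    have h2 := norm_mul_le (star (x - y)) y
    rw [norm_star] at h2
    have h3 := norm_add_le (x * (x - y)) (star (x - y) * y)
    nlinarith [norm_nonneg (x - y)]
end

section
/- Let H be a complex Hilbert space, let A, B be C*-subalgebras of B(H), let 0 < α < 1/27, and suppose that for every x in the closed unit ball of A there exists y in the closed unit ball of B with ‖x−y‖ < α. Let a ∈ A and b ∈ B be positive contractions with ‖a−b‖ < 2α, and let (a_n) be a very rapidly increasing sequence of positive contractions in A such that a ≾ a_{m₁} in A for some index m₁. Then there exists n₀ such that for every n ≥ n₀, every positive contraction b_n ∈ B with ‖b_n − a_n‖ < 2α, and every γ with 18α < γ < 2/3, one has (b−18α)₊ ≾ (b_n−γ)₊ in B. -/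
open Filter Topology Metric ComplexOrder

variable {H : Type*} [NormedAddCommGroup H] [InnerProductSpace ℂ H] [CompleteSpace H]

namespace Aux8

section
variable {E : Type*} [CStarAlgebra E] [PartialOrder E] [StarOrderedRing E]

lemma aux_mem0 (B : NonUnitalStarSubalgebra ℂ E) (hB : IsClosed (B : Set E)) {c : E} (hc : c ∈ B)
    (hs : IsSelfAdjoint c)
    (h : ℝ → ℝ) (h0 : h 0 = 0) (hh : Continuous h) : cfc h c ∈ B := by
  rw [← cfcₙ_eq_cfc hh.continuousOn h0]
  exact cfcₙ_mem (𝕜' := ℂ) (s := B) (hs := hB) h hc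

lemma aux_mem1 (B : NonUnitalStarSubalgebra ℂ E) (hB : IsClosed (B : Set E)) {c z : E} (hc : c ∈ B)
    (hz : z ∈ B) (hs : IsSelfAdjoint c)
    (h : ℝ → ℝ) (hh : Continuous h) : cfc h c * z ∈ B := by
  have h1 : cfc h c = algebraMap ℝ E (h 0) + cfc (fun t => h t - h 0) c := by
    rw [← cfc_const_add (h 0) (fun t => h t - h 0) c (by fun_prop) hs]
    simp
  rw [h1, add_mul]
  refine B.add_mem ?_ (B.mul_mem (aux_mem0 B hB hc hs _ (by simp) (by fun_prop)) hz)
  rw [← Algebra.smul_def, ← Complex.coe_smul]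
  exact B.smul_mem _ hz

lemma aux_rordam (B : NonUnitalStarSubalgebra ℂ E) (hB : IsClosed (B : Set E)) {b c : E}
    (hb : b ∈ B) (hc : c ∈ B) (hbs : IsSelfAdjoint b) (hc0 : 0 ≤ c) (ez e : ℝ) (hez : 0 ≤ ez)
    (hee : ez < e) (hle : b ≤ c + algebraMap ℝ E ez) (d : ℝ) (hd : 0 < d) :
    ∃ v ∈ B, ‖v * c * star v - cfc (fun t : ℝ => max (t - e) 0) b‖ ≤ d := by
  have hpos : ∀ t : ℝ, 0 < max (t - ez) (e - ez) := fun t => lt_max_of_lt_right (by linarith)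
  have hκp : ∀ t : ℝ, 0 < |t| + d := fun t => by positivity
  have hgc : Continuous (fun t : ℝ => √(max (t - e) 0 / max (t - ez) (e - ez))) := by
    refine Real.continuous_sqrt.comp (Continuous.div (by fun_prop) (by fun_prop) ?_)
    exact fun t => (hpos t).ne'
  have hκc : Continuous (fun t : ℝ => (√(|t| + d))⁻¹) := by
    refine Continuous.inv₀ (by fun_prop) ?_
    exact fun t => (Real.sqrt_pos.2 (hκp t)).ne'
  have hsc : Continuous (fun t : ℝ => √(max (t - e) 0)) := by fun_prop
  set g := cfc (fun t : ℝ => √(max (t - e) 0 / max (t - ez) (e - ez))) b with hg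
  set s := cfc (fun t : ℝ => √(max (t - e) 0)) b with hs
  have hgs : star g = g := (cfc_predicate (R := ℝ) _ b : IsSelfAdjoint g)
  have hss : star s = s := (cfc_predicate (R := ℝ) _ b : IsSelfAdjoint s)
  have hgB : g ∈ B := aux_mem0 B hB hb hbs _ (by
    have : max (0 - e) 0 = 0 := max_eq_right (by linarith)
    simp only [this]; simp) hgc
  have hsB : s ∈ B := aux_mem0 B hB hb hbs _ (by
    have : max (0 - e) 0 = 0 := max_eq_right (by linarith)
    simp only [this]; simp) hsc
  have hp : s * s = cfc (fun t : ℝ => max (t - e) 0) b := by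
    rw [hs, ← cfc_mul _ _ b (by fun_prop) (by fun_prop)]
    congr 1; ext t
    exact Real.mul_self_sqrt (le_max_right _ _)
  have hp2 : g * (b - algebraMap ℝ E ez) * g = s * s := by
    have : b - algebraMap ℝ E ez = cfc (fun t : ℝ => t - ez) b := by
      rw [cfc_sub (fun t => t) (fun _ => ez) b (by fun_prop) (by fun_prop), cfc_const ez b hbs,
        cfc_id' ℝ b hbs]
    rw [this, hp, hg, ← cfc_mul _ _ b hgc.continuousOn (by fun_prop),
      ← cfc_mul _ _ b (by exact (hgc.mul (by fun_prop)).continuousOn) hgc.continuousOn]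
    congr 1; ext t
    have h0 : 0 ≤ max (t - e) 0 / max (t - ez) (e - ez) :=
      div_nonneg (le_max_right _ _) (hpos t).le
    rw [mul_right_comm, Real.mul_self_sqrt h0]
    rcases le_total t e with h | h
    · rw [max_eq_right (a := t - e) (by linarith)]; simp
    · rw [max_eq_left (a := t - e) (by linarith), max_eq_left (by linarith)]
      exact div_mul_cancel₀ _ (by linarith)
  set q := g * c * g with hq
  have hq0 : 0 ≤ q := by
    have := star_right_conjugate_nonneg hc0 g
    rwa [hgs] at this
  have hqs : IsSelfAdjoint q := IsSelfAdjoint.of_nonneg hq0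
  have hqB : q ∈ B := B.mul_mem (B.mul_mem hgB hc) hgB
  have hpq : s * s ≤ q := by
    have := star_right_conjugate_le_conjugate (sub_le_iff_le_add.2 hle) g
    rwa [hgs, hp2] at this
  set k := cfc (fun t : ℝ => (√(|t| + d))⁻¹) q with hk
  have hks : star k = k := (cfc_predicate (R := ℝ) _ q : IsSelfAdjoint k)
  have hkk : k * q * k + d • (k * k) = 1 := by
    have h1 : k * q * k + d • (k * k) = cfc (fun t : ℝ => (√(|t| + d))⁻¹ * t * (√(|t| + d))⁻¹
        + d • ((√(|t| + d))⁻¹ * (√(|t| + d))⁻¹)) q := by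
      rw [cfc_add q _ _ (by exact ((hκc.mul continuous_id).mul hκc).continuousOn)
        (by exact ((hκc.mul hκc).const_smul d).continuousOn),
        cfc_smul d _ q (by exact (hκc.mul hκc).continuousOn),
        cfc_mul _ _ q (by exact (hκc.mul continuous_id).continuousOn) hκc.continuousOn,
        cfc_mul _ _ q hκc.continuousOn (by fun_prop),
        cfc_mul _ _ q hκc.continuousOn hκc.continuousOn, cfc_id' ℝ q hqs]
    rw [h1, ← cfc_one ℝ q hqs]
    refine cfc_congr fun t ht => ?_
    have ht0 : 0 ≤ t := spectrum_nonneg_of_nonneg hq0 ht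
    have h2 := Real.mul_self_sqrt (hκp t).le
    have h3 := (Real.sqrt_pos.2 (hκp t)).ne'
    rw [abs_of_nonneg ht0] at *
    simp only [Pi.one_apply, smul_eq_mul]
    field_simp
    nlinarith
  have hkp : k * (s * s) * k ≤ 1 := by
    have h1 := star_right_conjugate_le_conjugate hpq k
    rw [hks] at h1
    have h2 : 0 ≤ d • (k * k) := by
      refine smul_nonneg hd.le ?_
      have := mul_star_self_nonneg k
      rwa [hks] at this
    calc _ ≤ k * q * k := h1
      _ ≤ k * q * k + d • (k * k) := le_add_of_nonneg_right h2
      _ = 1 := hkk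
  have hn : ‖s * k * (k * s)‖ ≤ 1 := by
    have e1 : s * k * (k * s) = star (k * s) * (k * s) := by rw [star_mul, hks, hss]
    have e2 : k * (s * s) * k = (k * s) * star (k * s) := by
      rw [star_mul, hks, hss]; simp only [mul_assoc]
    rw [e1, CStarRing.norm_star_mul_self, ← CStarRing.norm_self_mul_star, ← e2]
    refine (CStarAlgebra.norm_le_one_iff_of_nonneg _ ?_).2 hkp
    rw [e2]; exact mul_star_self_nonneg _
  refine ⟨s * (k * g), B.mul_mem hsB (aux_mem1 B hB hqB hgB hqs _ hκc), ?_⟩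
  have : s * (k * g) * c * star (s * (k * g)) - cfc (fun t : ℝ => max (t - e) 0) b
      = - (d • (s * k * (k * s))) := by
    rw [← hp, star_mul, star_mul, hks, hgs, hss]
    have : s * (k * g) * c * (g * k * s) = s * (k * q * k) * s := by
      rw [hq]; simp only [mul_assoc]
    rw [this, eq_sub_of_add_eq hkk, mul_sub, sub_mul, mul_one, mul_smul_comm, smul_mul_assoc]
    simp only [mul_assoc]; abel
  rw [this, norm_neg, norm_smul, Real.norm_of_nonneg hd.le]
  nlinarith

lemma aux_le {x y : E} (hx : IsSelfAdjoint x) (hy : IsSelfAdjoint y) {r : ℝ} (h : ‖x - y‖ ≤ r) :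
    x ≤ y + algebraMap ℝ E r := by
  have h1 := (hx.sub hy).le_algebraMap_norm_self
  have h2 : algebraMap ℝ E ‖x - y‖ ≤ algebraMap ℝ E r := algebraMap_mono E h
  rw [add_comm]
  exact sub_le_iff_le_add.1 (h1.trans h2)

lemma aux_one_sub {a : E} (ha : 0 ≤ a) (ha1 : ‖a‖ ≤ 1) : 0 ≤ 1 - a ∧ ‖1 - a‖ ≤ 1 := by
  have h := (CStarAlgebra.norm_le_one_iff_of_nonneg a ha).1 ha1
  have h0 : 0 ≤ 1 - a := sub_nonneg.2 h
  exact ⟨h0, (CStarAlgebra.norm_le_one_iff_of_nonneg _ h0).2 (sub_le_self _ ha)⟩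

/-- the approximating element in `A`, given the unit-like element -/
lemma aux_x {w r v am a : E} (hr : IsSelfAdjoint r) (ham : 0 ≤ am) (ham1 : ‖am‖ ≤ 1)
    (hv : ‖v‖ ≤ 1) (ha : IsSelfAdjoint a) {d n : ℝ}
    (h1 : ‖w * (r * r) * star w‖ ≤ 1) (h2 : ‖w * (r * r) * star w - a‖ ≤ d)
    (h3 : ‖w * (r * r) * star w - w * r * (v * am * star v) * r * star w‖ ≤ n) :
    ‖w * r * v‖ ≤ 1 ∧ a ≤ (w * r * v) * star (w * r * v) + algebraMap ℝ E (d + n) ∧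
      ‖(w * r * v) * (1 - am) * star (w * r * v)‖ ≤ n := by
  obtain ⟨hm0, hm1⟩ := aux_one_sub ham ham1
  have hx : star (w * r * v) = star v * r * star w := by
    simp only [star_mul, hr.star_eq, mul_assoc]
  set x := w * r * v with hxd
  have hp : w * (r * r) * star w = (w * r) * star (w * r) := by
    simp only [star_mul, hr.star_eq, mul_assoc]
  have hps : IsSelfAdjoint (w * (r * r) * star w) := by
    rw [hp]; exact IsSelfAdjoint.mul_star_self (w * r)
  have hvv : v * star v ≤ 1 := by
    refine (CStarAlgebra.norm_le_one_iff_of_nonneg _ (mul_star_self_nonneg v)).1 ?_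
    rw [CStarRing.norm_self_mul_star]
    nlinarith [norm_nonneg v]
  have hxx : x * star x ≤ w * (r * r) * star w := by
    have := star_right_conjugate_le_conjugate hvv (w * r)
    rw [mul_one, ← hp] at this
    convert this using 1
    rw [hxd]; simp only [star_mul, mul_assoc]
  have e1 : x * am * star x = w * r * (v * am * star v) * r * star w := by
    rw [hx, hxd]; simp only [mul_assoc]
  rw [← e1] at h3
  have e2 : x * (1 - am) * star x = x * star x - x * am * star x := by
    rw [mul_sub, sub_mul, mul_one]
  have h0 : 0 ≤ x * (1 - am) * star x := star_right_conjugate_nonneg hm0 x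
  refine ⟨?_, ?_, ?_⟩
  · have := (CStarAlgebra.norm_le_norm_of_nonneg_of_le (mul_star_self_nonneg x) hxx).trans h1
    rw [CStarRing.norm_self_mul_star] at this
    nlinarith [norm_nonneg x]
  · have h4 := aux_le ha hps ((norm_sub_rev _ _).trans_le h2)
    have hxa : x * am * star x ≤ x * star x := by
      rw [e2] at h0; exact sub_nonneg.1 h0
    have h5 := aux_le hps
      (IsSelfAdjoint.of_nonneg (star_right_conjugate_nonneg ham x)) h3
    calc a ≤ _ := h4
      _ ≤ (x * am * star x + algebraMap ℝ E n) + algebraMap ℝ E d := by gcongr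
      _ ≤ (x * star x + algebraMap ℝ E n) + algebraMap ℝ E d := by gcongr
      _ = _ := by rw [map_add]; abel
  · refine (CStarAlgebra.norm_le_norm_of_nonneg_of_le h0 ?_).trans h3
    rw [e2]; exact sub_le_sub_right hxx _

/-- the lower bound in `B` -/
lemma aux_final {x y am bm a b : E} {α η γ : ℝ} (hη : 0 ≤ η) (hx1 : ‖x‖ ≤ 1) (hy1 : ‖y‖ ≤ 1)
    (hxy : ‖x - y‖ ≤ α) (hbm : 0 ≤ bm) (hbm1 : ‖bm‖ ≤ 1) (ham : IsSelfAdjoint am)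
    (hba : ‖bm - am‖ ≤ 2 * α)
    (has : IsSelfAdjoint a) (hbs : IsSelfAdjoint b) (hab : ‖a - b‖ ≤ 2 * α)
    (h1 : a ≤ x * star x + algebraMap ℝ E η) (h2 : ‖x * (1 - am) * star x‖ ≤ η)
    (hγ : γ < 2 / 3) :
    b ≤ (1 - γ)⁻¹ • (y * cfc (fun t : ℝ => max (t - γ) 0) bm * star y)
      + algebraMap ℝ E (16 * α + 4 * η) := by
  obtain ⟨hm0, hm1⟩ := aux_one_sub hbm hbm1
  have hα : 0 ≤ α := (norm_nonneg _).trans hxy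
  have hg1 : 0 < 1 - γ := by linarith
  have hg3 : (1 - γ)⁻¹ ≤ 3 := by
    rw [inv_le_comm₀ hg1 (by norm_num)]; linarith
  have hbmsa : IsSelfAdjoint bm := .of_nonneg hbm
  -- f
  have hf : 1 - (1 - γ)⁻¹ • cfc (fun t : ℝ => max (t - γ) 0) bm ≤ (3 : ℝ) • (1 - bm) := by
    have e1 : 1 - (1 - γ)⁻¹ • cfc (fun t : ℝ => max (t - γ) 0) bm =
        cfc (fun t : ℝ => 1 - (1 - γ)⁻¹ • max (t - γ) 0) bm := by
      rw [cfc_sub _ _ bm (by fun_prop) (by fun_prop), cfc_const 1 bm hbmsa, cfc_smul _ _ bm (by fun_prop), map_one]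
    have e2 : (3 : ℝ) • (1 - bm) = cfc (fun t : ℝ => (3 : ℝ) • (1 - t)) bm := by
      rw [cfc_smul _ _ bm (by fun_prop), cfc_sub _ _ bm (by fun_prop) (by fun_prop), cfc_const 1 bm hbmsa, map_one,
        cfc_id' ℝ bm hbmsa]
    rw [e1, e2]
    refine cfc_mono (fun t ht => ?_) (by fun_prop) (by fun_prop)
    have ht1 : t ≤ 1 := by
      have := spectrum.norm_le_norm_mul_of_mem ht
      have h1 : ‖(1 : E)‖ ≤ 1 := by
        have := aux_one_sub (le_refl (0:E)) (by simp)
        simpa using this.2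
      have := le_abs_self t
      rw [Real.norm_eq_abs] at *
      nlinarith [norm_nonneg bm]
    simp only [smul_eq_mul]
    have h5 : 1 - (1 - γ)⁻¹ * max (t - γ) 0 ≤ (1 - γ)⁻¹ * (1 - t) := by
      have : (1 - γ)⁻¹ * (1 - γ) = 1 := inv_mul_cancel₀ hg1.ne'
      have h6 : 0 < (1 - γ)⁻¹ := inv_pos.2 hg1
      nlinarith [le_max_left (t - γ) 0]
    nlinarith
  have hyf := star_right_conjugate_le_conjugate hf y
  have hsx : ∀ z : E, IsSelfAdjoint (z * star z) := fun z => IsSelfAdjoint.mul_star_self z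
  have hsy : IsSelfAdjoint (y * (1 - bm) * star y) :=
    .of_nonneg (star_right_conjugate_nonneg hm0 y)
  -- norm estimates
  have hxyst : ‖star x - star y‖ ≤ α := by rwa [← star_sub, norm_star]
  have n1 : ‖x * star x - y * star y‖ ≤ 2 * α := by
    have : x * star x - y * star y = (x - y) * star x + y * (star x - star y) := by noncomm_ring
    rw [this]
    refine (norm_add_le _ _).trans ?_
    have k1 := norm_mul_le_of_le hxy ((norm_star x).trans_le hx1)
    have k2 := norm_mul_le_of_le hy1 hxyst
    linarith
  have n2 : ‖y * (1 - bm) * star y‖ ≤ 4 * α + η := by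
    have : y * (1 - bm) * star y = x * (1 - am) * star x - x * (bm - am) * star x
      - (x - y) * (1 - bm) * star x - y * (1 - bm) * (star x - star y) := by noncomm_ring
    rw [this]
    have k1 := norm_mul_le_of_le (norm_mul_le_of_le hx1 hba) ((norm_star x).trans_le hx1)
    have k2 := norm_mul_le_of_le (norm_mul_le_of_le hxy hm1) ((norm_star x).trans_le hx1)
    have k3 := norm_mul_le_of_le (norm_mul_le_of_le hy1 hm1) hxyst
    refine (norm_sub_le _ _).trans ?_
    have l1 := norm_sub_le (x * (1 - am) * star x - x * (bm - am) * star x)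
      ((x - y) * (1 - bm) * star x)
    have l2 := norm_sub_le (x * (1 - am) * star x) (x * (bm - am) * star x)
    linarith
  have i1 := aux_le hbs has ((norm_sub_rev _ _).trans_le hab)
  have i2 := aux_le (hsx x) (hsx y) n1
  have i3 : y * (1 - bm) * star y ≤ algebraMap ℝ E (4 * α + η) := by
    have := aux_le hsy (IsSelfAdjoint.zero E) (by simpa using n2)
    simpa using this
  have i4 : y * star y ≤ (1 - γ)⁻¹ • (y * cfc (fun t : ℝ => max (t - γ) 0) bm * star y)
      + (3 : ℝ) • algebraMap ℝ E (4 * α + η) := by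
    have i5 := smul_le_smul_of_nonneg_left i3 (by norm_num : (0:ℝ) ≤ 3)
    rw [mul_sub, sub_mul, mul_one, mul_smul_comm, smul_mul_assoc, mul_smul_comm,
      smul_mul_assoc] at hyf
    rw [add_comm]
    exact sub_le_iff_le_add.1 (hyf.trans i5)
  calc b ≤ a + algebraMap ℝ E (2 * α) := i1
    _ ≤ (x * star x + algebraMap ℝ E η) + algebraMap ℝ E (2 * α) := by gcongr
    _ ≤ ((y * star y + algebraMap ℝ E (2 * α)) + algebraMap ℝ E η) + algebraMap ℝ E (2 * α) := by
      gcongr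
    _ ≤ ((((1 - γ)⁻¹ • (y * cfc (fun t : ℝ => max (t - γ) 0) bm * star y)
      + (3 : ℝ) • algebraMap ℝ E (4 * α + η)) + algebraMap ℝ E (2 * α)) + algebraMap ℝ E η)
        + algebraMap ℝ E (2 * α) := by gcongr
    _ = _ := by
      simp only [add_assoc]
      congr 1
      simp only [Algebra.algebraMap_eq_smul_one, smul_smul, ← add_smul]
      congr 1; ring
end

end Aux8

theorem stmt8 (A B : NonUnitalStarSubalgebra ℂ (H →L[ℂ] H))
    (hAc : IsClosed (A : Set (H →L[ℂ] H))) (hBc : IsClosed (B : Set (H →L[ℂ] H)))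
    (α : ℝ) (hα0 : 0 < α) (hα : α < 1 / 27)
    (hAB : ∀ x ∈ A, ‖x‖ ≤ 1 → ∃ y ∈ B, ‖y‖ ≤ 1 ∧ ‖x - y‖ < α)
    (a b : H →L[ℂ] H) (haA : a ∈ A) (hbB : b ∈ B)
    (ha : 0 ≤ a) (ha1 : ‖a‖ ≤ 1) (hb : 0 ≤ b) (hb1 : ‖b‖ ≤ 1)
    (hab : ‖a - b‖ < 2 * α)
    (as : ℕ → H →L[ℂ] H) (hasA : ∀ n, as n ∈ A)
    (haspos : ∀ n, 0 ≤ as n) (has1 : ∀ n, ‖as n‖ ≤ 1)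
    (hvri : VeryRapidlyIncreasingIn (A : Set (H →L[ℂ] H)) as)
    (m₁ : ℕ) (hle : CuntzBelowIn (A : Set (H →L[ℂ] H)) a (as m₁)) :
    ∃ n₀, ∀ n ≥ n₀, ∀ bn : H →L[ℂ] H, bn ∈ B → 0 ≤ bn → ‖bn‖ ≤ 1 →
      ‖bn - as n‖ < 2 * α → ∀ γ : ℝ, 18 * α < γ → γ < 2 / 3 →
        CuntzBelowIn (B : Set (H →L[ℂ] H)) (cutP b (18 * α)) (cutP bn γ) := by
  have hass : IsSelfAdjoint a := .of_nonneg ha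
  have hbs : IsSelfAdjoint b := .of_nonneg hb
  obtain ⟨δ, hδ⟩ : ∃ δ : ℝ, δ = α / 10 := ⟨_, rfl⟩
  have hδ0 : 0 < δ := by rw [hδ]; positivity
  -- normalised implementing element
  obtain ⟨w, hwA, hw1, hw2⟩ : ∃ w ∈ A, ‖w * as m₁ * star w‖ ≤ 1 ∧
      ‖w * as m₁ * star w - a‖ ≤ 2 * δ := by
    obtain ⟨u, huA, hu⟩ := hle
    obtain ⟨N, hN⟩ := (hu.eventually_lt_const hδ0).exists
    have hP1 : ‖u N * as m₁ * star (u N)‖ ≤ 1 + δ := by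
      have := norm_sub_norm_le (u N * as m₁ * star (u N)) a
      linarith
    obtain ⟨c, hc⟩ : ∃ c : ℝ, c = (√(1 + δ))⁻¹ := ⟨_, rfl⟩
    have hcc : c * c = (1 + δ)⁻¹ := by
      rw [hc, ← mul_inv, Real.mul_self_sqrt (by linarith)]
    have hc1 : (1 + δ)⁻¹ * (1 + δ) = 1 := inv_mul_cancel₀ (by linarith)
    have hc2 : 0 < (1 + δ)⁻¹ := by positivity
    have he : ((c : ℂ) • u N) * as m₁ * star ((c : ℂ) • u N)
        = (1 + δ)⁻¹ • (u N * as m₁ * star (u N)) := by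
      rw [star_smul, smul_mul_assoc, smul_mul_assoc, mul_smul_comm, smul_smul, ← hcc,
        ← Complex.coe_smul]
      simp
    refine ⟨(c : ℂ) • u N, A.smul_mem _ (huA N), ?_, ?_⟩
    · rw [he, norm_smul, Real.norm_of_nonneg hc2.le]
      nlinarith
    · rw [he]
      have : (1 + δ)⁻¹ • (u N * as m₁ * star (u N)) - a
          = (u N * as m₁ * star (u N) - a) - (1 - (1 + δ)⁻¹) • (u N * as m₁ * star (u N)) := by
        rw [sub_smul, one_smul]; abel
      rw [this]
      refine (norm_sub_le _ _).trans ?_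
      have h3 : 0 ≤ 1 - (1 + δ)⁻¹ := by nlinarith
      rw [norm_smul, Real.norm_of_nonneg h3]
      have h4 := mul_le_mul_of_nonneg_left hP1 h3
      nlinarith
  -- square root of `as m₁`
  obtain ⟨r, hrA, hrs, hrr⟩ : ∃ r ∈ A, IsSelfAdjoint r ∧ r * r = as m₁ := by
    have hs1 : IsSelfAdjoint (as m₁) := .of_nonneg (haspos m₁)
    refine ⟨cfc Real.sqrt (as m₁), Aux8.aux_mem0 A hAc (hasA m₁) hs1 _ (by simp) (by fun_prop),
      cfc_predicate (R := ℝ) _ _, ?_⟩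
    rw [← cfc_mul _ _ _ (by fun_prop) (by fun_prop)]
    conv_rhs => rw [← cfc_id' ℝ (as m₁) hs1]
    refine cfc_congr fun t ht => ?_
    exact Real.mul_self_sqrt (spectrum_nonneg_of_nonneg (haspos m₁) ht)
  obtain ⟨K, hK⟩ : ∃ K : ℝ, K = ‖w‖ * ‖r‖ * ‖w‖ + 1 := ⟨_, rfl⟩
  have hK0 : 0 < K := by rw [hK]; positivity
  obtain ⟨n₀, hn₀⟩ := hvri.2 ((δ / K) ^ 2) (by positivity) m₁
  refine ⟨n₀, fun n hn bn hbnB hbn0 hbn1 hbna γ hγ1 hγ2 => ?_⟩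
  obtain ⟨v, hvA, hv1, hv2⟩ := hn₀ n hn
  have he0 : 0 ≤ v * as n * star v := star_right_conjugate_nonneg (haspos n) v
  have he1 : ‖v * as n * star v‖ ≤ 1 := by
    have := norm_mul_le_of_le (norm_mul_le_of_le hv1 (has1 n)) ((norm_star v).trans_le hv1)
    linarith
  obtain ⟨hm0, hm1⟩ := Aux8.aux_one_sub he0 he1
  have hms : IsSelfAdjoint (1 - v * as n * star v) := .of_nonneg hm0
  have hT : ‖(1 - v * as n * star v) * r‖ ≤ δ / K := by
    have h1 : ‖(1 - v * as n * star v) * r‖ ^ 2 ≤ (δ / K) ^ 2 := by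
      rw [sq, ← CStarRing.norm_self_mul_star, star_mul, hrs.star_eq, hms.star_eq]
      have : (1 - v * as n * star v) * r * (r * (1 - v * as n * star v))
          = -((v * as n * star v * as m₁ - as m₁) * (1 - v * as n * star v)) := by
        rw [← hrr]; noncomm_ring
      rw [this, norm_neg]
      have := norm_mul_le_of_le hv2.le hm1
      linarith
    exact (sq_le_sq₀ (norm_nonneg _) (by positivity)).1 h1
  rw [← hrr] at hw1 hw2
  have h3 : ‖w * (r * r) * star w - w * r * (v * as n * star v) * r * star w‖ ≤ δ := by
    have : w * (r * r) * star w - w * r * (v * as n * star v) * r * star w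
        = w * r * ((1 - v * as n * star v) * r) * star w := by noncomm_ring
    rw [this]
    have h4 := norm_mul_le_of_le (norm_mul_le_of_le (norm_mul_le w r) hT) (norm_star w).le
    have h5 : δ / K * K = δ := div_mul_cancel₀ _ hK0.ne'
    have h6 : 0 < δ / K := by positivity
    nlinarith
  obtain ⟨hx1, hx2, hx3⟩ := Aux8.aux_x hrs (haspos n) (has1 n) hv1 hass hw1 hw2 h3
  have hxA : w * r * v ∈ A := A.mul_mem (A.mul_mem hwA hrA) hvA
  obtain ⟨y, hyB, hy1, hxy⟩ := hAB _ hxA hx1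
  have hfin := Aux8.aux_final (η := 2 * δ + δ) (by linarith) hx1 hy1 hxy.le hbn0 hbn1
    (.of_nonneg (haspos n)) hbna.le hass hbs hab.le hx2 (hx3.trans (by linarith)) hγ2
  have hbns : IsSelfAdjoint bn := .of_nonneg hbn0
  have hg0 : 0 ≤ (1 - γ)⁻¹ := inv_nonneg.2 (by linarith)
  have hfB : cutP bn γ ∈ B :=
    Aux8.aux_mem0 B hBc hbnB hbns _ (max_eq_right (by linarith)) (by fun_prop)
  have hf0 : 0 ≤ cutP bn γ := cfc_nonneg fun t _ => le_max_right _ _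
  have hcB : (1 - γ)⁻¹ • (y * cutP bn γ * star y) ∈ B := by
    rw [← Complex.coe_smul]
    exact B.smul_mem _ (B.mul_mem (B.mul_mem hyB hfB) (star_mem (S := NonUnitalStarSubalgebra ℂ (H →L[ℂ] H)) (s := B) hyB))
  have hc0 : 0 ≤ (1 - γ)⁻¹ • (y * cutP bn γ * star y) :=
    smul_nonneg hg0 (star_right_conjugate_nonneg hf0 y)
  have hR := fun k : ℕ => Aux8.aux_rordam B hBc hbB hcB hbs hc0
    (16 * α + 4 * (2 * δ + δ)) (18 * α) (by positivity) (by rw [hδ]; linarith) hfin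
    (1 / ((k : ℝ) + 1)) (by positivity)
  choose u huB hu using hR
  refine ⟨fun k => (√((1 - γ)⁻¹) : ℂ) • (u k * y),
    fun k => B.smul_mem _ (B.mul_mem (huB k) hyB), ?_⟩
  refine squeeze_zero (fun k => norm_nonneg _) (fun k => ?_)
    tendsto_one_div_add_atTop_nhds_zero_nat
  refine le_trans (le_of_eq ?_) (hu k)
  congr 2
  have hss : (√((1 - γ)⁻¹) : ℂ) * star (√((1 - γ)⁻¹) : ℂ) = (((1 - γ)⁻¹ : ℝ) : ℂ) := by
    rw [← Complex.ofReal_inj.2 (Real.mul_self_sqrt hg0)]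
    simp
  rw [star_smul, star_mul, smul_mul_assoc, smul_mul_assoc, mul_smul_comm, smul_smul, hss,
    Complex.coe_smul, mul_smul_comm, smul_mul_assoc]
  simp only [mul_assoc]
end

section
/- Let H be a complex Hilbert space, let A, B be C*-subalgebras of B(H), let 0 < α < 1/27, and suppose that for every x in the closed unit ball of A there exists y in the closed unit ball of B with ‖x−y‖ < α. Let (a_n) and (a'_n) be very rapidly increasing sequences of positive contractions in A such that for every n there is m with a'_n ≾ a_m in A. Let (b_n) and (b'_n) be sequences of positive contractions in B with ‖a_n − b_n‖ < 2α and ‖a'_n − b'_n‖ < 2α for all n. Then for every n there exists m with (b'_n−18α)₊ ≾ (b_m−18α)₊ in B. -/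
open Filter Topology Metric ComplexOrder

variable {H : Type*} [NormedAddCommGroup H] [InnerProductSpace ℂ H] [CompleteSpace H]

namespace S9

lemma mem_cfc (B : NonUnitalStarSubalgebra ℂ (H →L[ℂ] H))
    (hBc : IsClosed (B : Set (H →L[ℂ] H))) {a : H →L[ℂ] H} (ha : a ∈ B)
    (f : ℝ → ℝ) (hf : Continuous f) (h0 : f 0 = 0) : cfc f a ∈ B := by
  rw [← cfcₙ_eq_cfc (hf := hf.continuousOn) (hf0 := h0)]
  exact cfcₙ_mem (𝕜' := ℂ) (hs := hBc) f ha

lemma sa_cfc (f : ℝ → ℝ) (a : H →L[ℂ] H) : star (cfc f a) = cfc f a :=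
  (cfc_predicate f a : IsSelfAdjoint _)

lemma order_cuntz (B : NonUnitalStarSubalgebra ℂ (H →L[ℂ] H))
    (hBc : IsClosed (B : Set (H →L[ℂ] H))) {s b : H →L[ℂ] H} (hs : star s = s)
    (hb : b ∈ B) (hle : s * s ≤ b) (ε : ℝ) (hε : 0 < ε) :
    ∃ h ∈ B, star h = h ∧ ‖s * h * b * h * s - s * s‖ ≤ 2 * ε := by
  have hss : 0 ≤ s * s := by
    have := star_mul_self_nonneg s
    rwa [hs] at this
  have hb0 : 0 ≤ b := hss.trans hle
  have hbsa : IsSelfAdjoint b := IsSelfAdjoint.of_nonneg hb0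
  have hspec : ∀ x ∈ spectrum ℝ b, 0 ≤ x := fun x hx => spectrum_nonneg_of_nonneg hb0 hx
  have hne : ∀ t : ℝ, |t| + ε ≠ 0 := fun t => by positivity
  have hc1 : Continuous (fun t : ℝ => √t / (|t| + ε)) := by
    fun_prop (disch := exact hne _)
  have hc2 : Continuous (fun t : ℝ => √ (1 - (|t| / (|t| + ε)) ^ 2)) := by
    refine Real.continuous_sqrt.comp ?_
    exact continuous_const.sub ((continuous_abs.div (by fun_prop) hne).pow 2)
  set h := cfc (fun t : ℝ => √t / (|t| + ε)) b with hh
  set u := cfc (fun t : ℝ => √ (1 - (|t| / (|t| + ε)) ^ 2)) b with hu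
  have hhs : star h = h := sa_cfc _ _
  have hus : star u = u := sa_cfc _ _
  have hle1 : ∀ t : ℝ, (|t| / (|t| + ε)) ^ 2 ≤ 1 := fun t => by
    have h1 : |t| / (|t| + ε) ≤ 1 := by
      rw [div_le_one (by positivity)]; linarith
    have h2 : 0 ≤ |t| / (|t| + ε) := by positivity
    nlinarith
  refine ⟨h, mem_cfc B hBc hb _ hc1 (by simp), hhs, ?_⟩
  have e1 : h * b * h = 1 - u * u := by
    have : b = cfc (fun t : ℝ => t) b := (cfc_id' ℝ b).symm
    have e2 : u * u = cfc (fun t : ℝ => 1 - (|t| / (|t| + ε)) ^ 2) b := by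
      rw [hu, ← cfc_mul _ _ b hc2.continuousOn hc2.continuousOn]
      refine cfc_congr fun t _ => ?_
      exact Real.mul_self_sqrt (by linarith [hle1 t])
    have e3 : h * b * h = cfc (fun t : ℝ => (|t| / (|t| + ε)) ^ 2) b := by
      conv_lhs => rw [hh]; arg 1; arg 2; rw [this]
      rw [← cfc_mul _ _ b hc1.continuousOn (by fun_prop),
        ← cfc_mul _ _ b (by fun_prop) hc1.continuousOn]
      refine cfc_congr fun t ht => ?_
      have h0 := hspec t ht
      have := Real.mul_self_sqrt h0
      simp only [abs_of_nonneg h0]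
      calc √t / (t + ε) * t * (√t / (t + ε)) = (√t * √t) * t / (t+ε)^2 := by
            rw [div_mul_eq_mul_div, div_mul_div_comm]; congr 1 <;> ring
        _ = _ := by rw [this, div_pow]; congr 1; ring
    rw [e2, e3, ← cfc_const_one ℝ b, ← cfc_sub (fun _ : ℝ => (1:ℝ))
      (fun t : ℝ => 1 - (|t| / (|t| + ε)) ^ 2) b (by fun_prop)
      (continuous_const.sub ((continuous_abs.div (by fun_prop) hne).pow 2)).continuousOn]
    refine cfc_congr fun t _ => ?_
    simp
  have e4 : s * h * b * h * s - s * s = - ((s * u) * star (s * u)) := by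
    rw [star_mul, hs, hus]
    calc _ = s * (h * b * h) * s - s * s := by noncomm_ring
      _ = _ := by rw [e1]; noncomm_ring
  rw [e4, norm_neg, CStarRing.norm_self_mul_star, ← CStarRing.norm_star_mul_self, star_mul, hs, hus]
  have h5 : u * (s * s) * u ≤ u * b * u := by
    have := star_left_conjugate_le_conjugate hle u
    rwa [hus] at this
  have h6 : 0 ≤ u * (s * s) * u := by
    have := star_left_conjugate_nonneg hss u
    rwa [hus] at this
  have h7 : u * s * (s * u) = u * (s * s) * u := by noncomm_ring
  rw [h7]
  refine (CStarAlgebra.norm_le_norm_of_nonneg_of_le h6 h5).trans ?_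
  have e5 : u * b * u = cfc (fun t : ℝ => √ (1 - (|t| / (|t| + ε)) ^ 2) * t * √ (1 - (|t| / (|t| + ε)) ^ 2)) b := by
    have : b = cfc (fun t : ℝ => t) b := (cfc_id' ℝ b).symm
    conv_lhs => rw [hu]; arg 1; arg 2; rw [this]
    rw [← cfc_mul _ _ b hc2.continuousOn (by fun_prop),
      ← cfc_mul (fun t : ℝ => √ (1 - (|t| / (|t| + ε)) ^ 2) * t) _ b (hc2.mul continuous_id').continuousOn hc2.continuousOn]
  rw [e5]
  refine norm_cfc_le (by positivity) fun t ht => ?_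
  have h0 := hspec t ht
  have hm := Real.mul_self_sqrt (show 0 ≤ 1 - (|t| / (|t| + ε)) ^ 2 by linarith [hle1 t])
  have : √ (1 - (|t| / (|t| + ε)) ^ 2) * t * √ (1 - (|t| / (|t| + ε)) ^ 2)
    = t * (1 - (|t| / (|t| + ε)) ^ 2) := by
    rw [← hm]; ring_nf; rw [Real.sqrt_sq (Real.sqrt_nonneg _)]
  rw [this, abs_of_nonneg h0, Real.norm_of_nonneg (by have := hle1 t; rw [abs_of_nonneg h0] at this; exact mul_nonneg h0 (by linarith))]
  rw [div_pow, one_sub_div (by positivity), mul_div_assoc', div_le_iff₀ (by positivity)]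
  nlinarith [mul_nonneg h0 hε.le, mul_nonneg h0 h0, mul_pos hε hε, mul_pos (mul_pos hε hε) hε, mul_nonneg h0 (mul_pos hε hε).le]

end S9
namespace S9

lemma nonneg_sqrt_spec (A : NonUnitalStarSubalgebra ℂ (H →L[ℂ] H))
    (hAc : IsClosed (A : Set (H →L[ℂ] H))) {a : H →L[ℂ] H} (ha : a ∈ A) (h0 : 0 ≤ a) :
    ∃ q ∈ A, star q = q ∧ q * q = a := by
  have hsa : IsSelfAdjoint a := IsSelfAdjoint.of_nonneg h0
  refine ⟨cfc (fun t : ℝ => √t) a, mem_cfc A hAc ha _ (by fun_prop) (by simp), sa_cfc _ _, ?_⟩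
  rw [← cfc_mul _ _ a (by fun_prop) (by fun_prop)]
  conv_rhs => rw [← cfc_id' ℝ a]
  refine cfc_congr fun t ht => ?_
  exact Real.mul_self_sqrt (spectrum_nonneg_of_nonneg h0 ht)

lemma norm_conj_le {E : Type*} [NonUnitalNormedRing E] [StarRing E] [NormedStarGroup E]
    (v x : E) : ‖v * x * star v‖ ≤ ‖v‖ ^ 2 * ‖x‖ := by
  calc ‖v * x * star v‖ ≤ ‖v‖ * ‖x‖ * ‖star v‖ := norm_mul₃_le
    _ = ‖v‖ ^ 2 * ‖x‖ := by rw [norm_star]; ring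

lemma norm_conj_le' {E : Type*} [NonUnitalNormedRing E] [StarRing E] [NormedStarGroup E]
    (v x : E) (hv : ‖v‖ ≤ 1) : ‖v * x * star v‖ ≤ ‖x‖ := by
  refine (norm_conj_le v x).trans ?_
  have : ‖v‖ ^ 2 ≤ 1 := pow_le_one₀ (norm_nonneg _) hv
  nlinarith [norm_nonneg x]

lemma contr (A : NonUnitalStarSubalgebra ℂ (H →L[ℂ] H))
    (hAc : IsClosed (A : Set (H →L[ℂ] H)))
    (as : ℕ → H →L[ℂ] H) (hasA : ∀ n, as n ∈ A)
    (haspos : ∀ n, 0 ≤ as n) (has1 : ∀ n, ‖as n‖ ≤ 1)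
    (hv : ∀ ε > (0 : ℝ), ∀ n, ∃ m₀, ∀ m ≥ m₀,
      ∃ v ∈ (A : Set (H →L[ℂ] H)), ‖v‖ ≤ 1 ∧ ‖v * as m * star v * as n - as n‖ < ε)
    (c : H →L[ℂ] H) (hc1 : ‖c‖ ≤ 1) (k : ℕ)
    (hck : CuntzBelowIn (A : Set (H →L[ℂ] H)) c (as k))
    (η : ℝ) (hη : 0 < η) (hη1 : η ≤ 1) :
    ∃ M, ∃ w ∈ A, ‖w‖ ≤ 1 ∧ ‖w * as M * star w - c‖ ≤ 6 * η := by
  obtain ⟨vs, hvsA, hvs⟩ := hck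
  obtain ⟨i, hi⟩ := ((tendsto_order.1 hvs).2 η hη).exists
  set v := vs i with hvdef
  have hvA : v ∈ A := hvsA i
  obtain ⟨q, hqA, hqs, hqq⟩ := nonneg_sqrt_spec A hAc (hasA k) (haspos k)
  have hq1 : ‖q‖ ^ 2 ≤ 1 := by
    have := CStarRing.norm_star_mul_self (x := q)
    rw [hqs, hqq] at this
    rw [sq, ← this]; exact has1 k
  have hq1' : ‖q‖ ≤ 1 := by nlinarith [norm_nonneg q]
  set N := ‖v‖ ^ 2 + 1 with hN
  have hNpos : 0 < N := by positivity
  obtain ⟨M, hM⟩ := hv ((η / N) ^ 2 / 2) (by positivity) k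
  obtain ⟨u, huA, hu1, hue⟩ := hM M le_rfl
  set e := u * as M * star u with he
  have hes : star e = e := by
    rw [he]; simp [mul_assoc, (IsSelfAdjoint.of_nonneg (haspos M)).star_eq]
  have he1 : ‖e‖ ≤ 1 := (norm_conj_le' u _ hu1).trans (has1 M)
  have hone : ‖(1 : H →L[ℂ] H)‖ ≤ 1 := ContinuousLinearMap.norm_id_le
  have hem : ‖e - 1‖ ≤ 2 := (norm_sub_le _ _).trans (by linarith)
  have hkey : ‖(e - 1) * q‖ ≤ η / N := by
    have h1 : ‖(e - 1) * q‖ * ‖(e - 1) * q‖ ≤ (η / N) ^ 2 := by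
      rw [← CStarRing.norm_self_mul_star]
      have : (e - 1) * q * star ((e - 1) * q) = (e * as k - as k) * (e - 1) := by
        rw [star_mul, star_sub, hqs, hes, star_one, ← hqq]; noncomm_ring
      rw [this]
      refine (norm_mul_le _ _).trans ?_
      nlinarith [norm_nonneg (e - 1), norm_nonneg (e * as k - as k)]
    have h2 : 0 ≤ η / N := by positivity
    exact abs_le_of_sq_le_sq' (by nlinarith) h2 |>.2
  set x := v * q with hx
  have hxA : x ∈ A := mul_mem hvA hqA
  have hxx : x * star x = v * as k * star v := by
    rw [hx, star_mul, hqs, ← hqq]; noncomm_ring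
  have hx2 : ‖x‖ * ‖x‖ ≤ 1 + η := by
    rw [← CStarRing.norm_self_mul_star, hxx]
    calc ‖v * as k * star v‖ = ‖(v * as k * star v - c) + c‖ := by simp
      _ ≤ ‖v * as k * star v - c‖ + ‖c‖ := norm_add_le _ _
      _ ≤ 1 + η := by linarith
  have hxe : ‖x * e * star x - x * star x‖ ≤ η := by
    have : x * e * star x - x * star x = v * (q * ((e - 1) * q)) * star v := by
      rw [hx, star_mul, hqs]; noncomm_ring
    rw [this]
    have h3 : ‖q * ((e - 1) * q)‖ ≤ η / N := by
      refine (norm_mul_le _ _).trans ?_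
      nlinarith [norm_nonneg ((e - 1) * q)]
    calc _ ≤ ‖v‖ ^ 2 * ‖q * ((e - 1) * q)‖ := norm_conj_le _ _
      _ ≤ N * (η / N) := by gcongr; linarith
      _ = η := by field_simp
  set r : ℝ := (1 + η)⁻¹ with hr
  have hr0 : 0 < r := by positivity
  have hr1 : r * (1 + η) = 1 := inv_mul_cancel₀ (by positivity)
  have hrle : r ≤ 1 := by nlinarith
  have hxn : ‖x‖ ≤ 1 + η := by nlinarith [norm_nonneg x]
  refine ⟨M, (r : ℂ) • (x * u), SMulMemClass.smul_mem _ (mul_mem hxA huA), ?_, ?_⟩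
  · rw [norm_smul, Complex.norm_real, Real.norm_of_nonneg hr0.le]
    have : ‖x * u‖ ≤ 1 + η := (norm_mul_le _ _).trans (by nlinarith [norm_nonneg x, norm_nonneg u])
    nlinarith
  · have e1 : ((r : ℂ) • (x * u)) * as M * star ((r : ℂ) • (x * u)) - c
        = ((r ^ 2 - 1 : ℝ) : ℂ) • (x * e * star x) + (x * e * star x - x * star x) + (v * as k * star v - c) := by
      rw [hxx, star_smul, star_mul, he]
      simp only [smul_mul_assoc, mul_smul_comm, smul_smul, mul_assoc]
      push_cast
      rw [sub_smul, one_smul, Complex.star_def, Complex.conj_ofReal, ← sq]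
      abel
    rw [e1]
    have h7 : 0 ≤ 1 - r ^ 2 := by
      have : r ^ 2 ≤ 1 := pow_le_one₀ hr0.le hrle
      linarith
    have h6 : 1 - r ^ 2 ≤ 2 * η := by
      have h61 : 1 - r = r * η := by linarith
      have h62 : r * η ≤ η := mul_le_of_le_one_left hη.le hrle
      calc 1 - r ^ 2 = (1 - r) * (1 + r) := by ring
        _ ≤ η * 2 := by gcongr <;> linarith
        _ = 2 * η := by ring
    have h5 : ‖x * e * star x‖ ≤ 2 := by
      refine (norm_conj_le _ _).trans ?_
      calc ‖x‖ ^ 2 * ‖e‖ ≤ (1 + η) * 1 := by gcongr; rw [sq]; exact hx2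
        _ ≤ 2 := by linarith
    have h4 : ‖((r ^ 2 - 1 : ℝ) : ℂ) • (x * e * star x)‖ ≤ 4 * η := by
      rw [norm_smul, Complex.norm_real, Real.norm_eq_abs, abs_sub_comm, abs_of_nonneg h7]
      calc (1 - r ^ 2) * ‖x * e * star x‖ ≤ (2 * η) * 2 := by gcongr
        _ = 4 * η := by ring
    refine (norm_add₃_le).trans ?_
    linarith

lemma norm_one_sub {f : H →L[ℂ] H} (h0 : 0 ≤ f) (h1 : ‖f‖ ≤ 1) : ‖1 - f‖ ≤ 1 := by
  have h2 : f ≤ 1 := (CStarAlgebra.norm_le_one_iff_of_nonneg f h0).1 h1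
  exact (CStarAlgebra.norm_le_one_iff_of_nonneg (1 - f) (sub_nonneg.2 h2)).2 (sub_le_self _ h0)

lemma core (B : NonUnitalStarSubalgebra ℂ (H →L[ℂ] H))
    (hBc : IsClosed (B : Set (H →L[ℂ] H))) (r θ : ℝ) (hr : 0 < r) (hθ : 1 / 9 + θ < 1)
    (b f g w : H →L[ℂ] H) (hbB : b ∈ B) (hgB : g ∈ B) (hwB : w ∈ B)
    (hb0 : 0 ≤ b) (hf0 : 0 ≤ f) (hg : star g = g)
    (hfb : ‖(1 - f) * b‖ ≤ r / 9) (hfw : ‖f - w * g * star w‖ ≤ θ) :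
    CuntzBelowIn (B : Set (H →L[ℂ] H)) (cutP b r) g := by
  have hbsa : IsSelfAdjoint b := IsSelfAdjoint.of_nonneg hb0
  have hspec : ∀ x ∈ spectrum ℝ b, 0 ≤ x := fun x hx => spectrum_nonneg_of_nonneg hb0 hx
  have hmax : ∀ t : ℝ, 0 < max t r := fun t => lt_max_of_lt_right hr
  have hck : Continuous (fun t : ℝ => (max t r)⁻¹) :=
    (by fun_prop : Continuous (fun t : ℝ => max t r)).inv₀ fun t => (hmax t).ne'
  have hcs : Continuous (fun t : ℝ => √ (max (t - r) 0)) := by fun_prop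
  set s := cfc (fun t : ℝ => √ (max (t - r) 0)) b with hs
  set k := cfc (fun t : ℝ => (max t r)⁻¹) b with hk
  have hss : star s = s := sa_cfc _ _
  have hks : star k = k := sa_cfc _ _
  have hsB : s ∈ B := mem_cfc B hBc hbB _ hcs (by simp [hr.le])
  have hs2 : s * s = cutP b r := by
    rw [hs, ← cfc_mul _ _ b hcs.continuousOn hcs.continuousOn, cutP]
    exact cfc_congr fun t _ => Real.mul_self_sqrt (le_max_right _ _)
  have hbk : b * k = cfc (fun t : ℝ => t * (max t r)⁻¹) b := by
    conv_lhs => arg 1; rw [← cfc_id' ℝ b]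
    rw [hk, ← cfc_mul _ _ b (by fun_prop) hck.continuousOn]
  have hbk1 : ‖b * k‖ ≤ 1 := by
    rw [hbk]
    refine norm_cfc_le zero_le_one fun t ht => ?_
    have h0 := hspec t ht
    rw [Real.norm_of_nonneg (mul_nonneg h0 (inv_nonneg.2 (hmax t).le)), ← div_eq_mul_inv,
      div_le_one (hmax t)]
    exact le_max_left _ _
  have hk1 : ‖k‖ ≤ r⁻¹ := by
    refine norm_cfc_le (by positivity) fun t ht => ?_
    rw [Real.norm_of_nonneg (inv_nonneg.2 (hmax t).le)]
    exact inv_anti₀ hr (le_max_right _ _)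
  have hbks : b * k * s = s := by
    rw [hbk, hs, ← cfc_mul (fun t : ℝ => t * (max t r)⁻¹) _ b (continuous_id'.mul hck).continuousOn hcs.continuousOn]
    refine cfc_congr fun t _ => ?_
    rcases le_total t r with h | h
    · simp [max_eq_right (sub_nonpos.2 h)]
    · have : t ≠ 0 := by linarith
      simp [max_eq_left h, this]
  -- the compression of `1 - X`
  set X := w * g * star w with hX
  have hXs : star X = X := by rw [hX]; simp [mul_assoc, hg]
  have hfs : star f = f := (IsSelfAdjoint.of_nonneg hf0).star_eq
  set Y := star (b * k) * (1 - X) * (b * k) with hY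
  have hYs : IsSelfAdjoint Y := by
    rw [IsSelfAdjoint, hY]; simp [mul_assoc, hXs]
  have hY1 : ‖Y‖ ≤ 1 / 9 + θ := by
    have : Y = star (b * k) * (((1 - f) * b) * k) + star (b * k) * (f - X) * (b * k) := by
      rw [hY]; noncomm_ring
    rw [this]
    refine (norm_add_le _ _).trans (add_le_add ?_ ?_)
    · calc _ ≤ ‖star (b * k)‖ * (‖(1 - f) * b‖ * ‖k‖) :=
            (norm_mul_le _ _).trans (by gcongr; exact norm_mul_le _ _)
        _ ≤ 1 * (r / 9 * r⁻¹) := by rw [norm_star]; gcongr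
        _ = 1 / 9 := by field_simp
    · refine norm_mul₃_le.trans ?_
      rw [norm_star]
      calc _ ≤ 1 * θ * 1 := by rw [one_mul]; exact mul_le_mul (mul_le_of_le_one_left (norm_nonneg _) hbk1 |>.trans hfw) hbk1 (norm_nonneg _) ((norm_nonneg _).trans hfw)
        _ = θ := by ring
  have hsYs : s * Y * s = s * s - s * X * s := by
    have h2 : s * star (b * k) = s := by
      have := congrArg star hbks
      rwa [star_mul, hss] at this
    calc s * Y * s = (s * star (b * k)) * (1 - X) * (b * k * s) := by rw [hY]; noncomm_ring
      _ = _ := by rw [h2, hbks]; noncomm_ring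
  have hord : s * s - s * X * s ≤ (1 / 9 + θ) • (s * s) := by
    have h3 := CStarAlgebra.star_left_conjugate_le_norm_smul (a := s) (b := Y) hYs
    rw [hss, hsYs] at h3
    refine h3.trans ?_
    have : 0 ≤ s * s := by
      have := star_mul_self_nonneg s
      rwa [hss] at this
    exact smul_le_smul_of_nonneg_right hY1 this
  set κ : ℝ := 1 - (1 / 9 + θ) with hκ
  have hκ0 : 0 < κ := by linarith
  have hord2 : κ • (s * s) ≤ s * X * s := by
    rw [hκ, sub_smul, one_smul]
    rw [sub_le_iff_le_add] at hord ⊢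
    rwa [add_comm]
  have hord3 : s * s ≤ κ⁻¹ • (s * X * s) := by
    have := smul_le_smul_of_nonneg_left hord2 (inv_nonneg.2 hκ0.le)
    rwa [smul_smul, inv_mul_cancel₀ hκ0.ne', one_smul] at this
  have hXB : X ∈ B := mul_mem (mul_mem hwB hgB) (star_mem hwB)
  have hbb : κ⁻¹ • (s * X * s) ∈ B := by
    rw [← Complex.coe_smul]
    exact SMulMemClass.smul_mem _ (mul_mem (mul_mem hsB hXB) hsB)
  have hall : ∀ n : ℕ, ∃ v ∈ B, ‖v * g * star v - cutP b r‖ ≤ 2 * (1 / ((n : ℝ) + 1)) := by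
    intro n
    obtain ⟨h, hhB, hhs, hhn⟩ := order_cuntz B hBc hss hbb hord3 (1 / ((n : ℝ) + 1)) (by positivity)
    refine ⟨((√ (κ⁻¹) : ℝ) : ℂ) • (s * h * s * w), SMulMemClass.smul_mem _
      (mul_mem (mul_mem (mul_mem hsB hhB) hsB) hwB), ?_⟩
    convert hhn using 2
    rw [hs2]
    congr 1
    have h4 : (((√ κ⁻¹ : ℝ) : ℂ) * ((√ κ⁻¹ : ℝ) : ℂ)) = ((κ⁻¹ : ℝ) : ℂ) := by
      rw [← Complex.ofReal_mul, Real.mul_self_sqrt (by positivity)]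
    rw [← Complex.coe_smul (κ⁻¹), ← h4, star_smul, hX]
    simp only [star_mul, hss, hhs, smul_mul_assoc, mul_smul_comm, smul_smul, mul_assoc,
      Complex.star_def, Complex.conj_ofReal]
  choose v hvB hvn using hall
  refine ⟨v, hvB, ?_⟩
  refine squeeze_zero (fun _ => norm_nonneg _) hvn ?_
  simpa using (tendsto_one_div_add_atTop_nhds_zero_nat (𝕜 := ℝ)).const_mul 2

end S9

theorem stmt9 (A B : NonUnitalStarSubalgebra ℂ (H →L[ℂ] H))
    (hAc : IsClosed (A : Set (H →L[ℂ] H))) (hBc : IsClosed (B : Set (H →L[ℂ] H)))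
    (α : ℝ) (hα0 : 0 < α) (hα : α < 1 / 27)
    (hAB : ∀ x ∈ A, ‖x‖ ≤ 1 → ∃ y ∈ B, ‖y‖ ≤ 1 ∧ ‖x - y‖ < α)
    (as as' : ℕ → H →L[ℂ] H) (hasA : ∀ n, as n ∈ A) (hasA' : ∀ n, as' n ∈ A)
    (haspos : ∀ n, 0 ≤ as n) (has1 : ∀ n, ‖as n‖ ≤ 1)
    (haspos' : ∀ n, 0 ≤ as' n) (has1' : ∀ n, ‖as' n‖ ≤ 1)
    (hvri : VeryRapidlyIncreasingIn (A : Set (H →L[ℂ] H)) as)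
    (hvri' : VeryRapidlyIncreasingIn (A : Set (H →L[ℂ] H)) as')
    (hdom : ∀ n, ∃ m, CuntzBelowIn (A : Set (H →L[ℂ] H)) (as' n) (as m))
    (bs bs' : ℕ → H →L[ℂ] H) (hbsB : ∀ n, bs n ∈ B) (hbsB' : ∀ n, bs' n ∈ B)
    (hbspos : ∀ n, 0 ≤ bs n) (hbs1 : ∀ n, ‖bs n‖ ≤ 1)
    (hbspos' : ∀ n, 0 ≤ bs' n) (hbs1' : ∀ n, ‖bs' n‖ ≤ 1)
    (hclose : ∀ n, ‖as n - bs n‖ < 2 * α) (hclose' : ∀ n, ‖as' n - bs' n‖ < 2 * α) :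
    ∀ n, ∃ m, CuntzBelowIn (B : Set (H →L[ℂ] H))
      (cutP (bs' n) (18 * α)) (cutP (bs m) (18 * α)) := by
  intro n
  set δ := 2 * α - ‖as' n - bs' n‖ with hδ
  have hδ0 : 0 < δ := by have := hclose' n; linarith
  obtain ⟨m₀, hm₀⟩ := hvri'.2 (δ / 2) (by positivity) n
  obtain ⟨v, hvA, hv1, hvn⟩ := hm₀ m₀ le_rfl
  obtain ⟨k, hk⟩ := hdom m₀
  obtain ⟨M, w, hwA, hw1, hwn⟩ := S9.contr A hAc as hasA haspos has1 hvri.2 (as' m₀) (has1' m₀) k hk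
    (min (δ / 12) 1) (by positivity) (min_le_right _ _)
  have hwn' : ‖w * as M * star w - as' m₀‖ ≤ δ / 2 :=
    hwn.trans (by linarith [min_le_left (δ / 12) 1])
  set x := v * w with hx
  have hxA : x ∈ A := mul_mem hvA hwA
  have hx1 : ‖x‖ ≤ 1 := (norm_mul_le _ _).trans (mul_le_one₀ hv1 (norm_nonneg _) hw1)
  obtain ⟨y, hyB, hy1, hxy⟩ := hAB x hxA hx1
  set f := x * as M * star x with hf
  have hf0 : 0 ≤ f := star_right_conjugate_nonneg (haspos M) x
  have hf1 : ‖f‖ ≤ 1 := (S9.norm_conj_le' x _ hx1).trans (has1 M)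
  have hfa : ‖(1 - f) * as' n‖ ≤ δ := by
    have : (1 - f) * as' n = -(v * (w * as M * star w - as' m₀) * star v * as' n)
        - (v * as' m₀ * star v * as' n - as' n) := by
      rw [hf, hx, star_mul]; noncomm_ring
    rw [this]
    refine (norm_sub_le _ _).trans ?_
    rw [norm_neg]
    have h1 : ‖v * (w * as M * star w - as' m₀) * star v * as' n‖ ≤ δ / 2 := by
      refine (norm_mul_le _ _).trans ?_
      calc _ ≤ (δ / 2) * 1 := mul_le_mul ((S9.norm_conj_le' v _ hv1).trans hwn') (has1' n)
            (norm_nonneg _) (by positivity)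
        _ = _ := mul_one _
    linarith
  have hfb : ‖(1 - f) * bs' n‖ ≤ 18 * α / 9 := by
    have : (1 - f) * bs' n = (1 - f) * as' n - (1 - f) * (as' n - bs' n) := by noncomm_ring
    rw [this]
    have h1 : ‖(1 - f) * (as' n - bs' n)‖ ≤ ‖as' n - bs' n‖ := by
      refine (norm_mul_le _ _).trans ?_
      exact mul_le_of_le_one_left (norm_nonneg _) (S9.norm_one_sub hf0 hf1)
    refine (norm_sub_le _ _).trans ?_
    linarith
  have hbsa : IsSelfAdjoint (bs M) := IsSelfAdjoint.of_nonneg (hbspos M)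
  have hcut : ‖bs M - cutP (bs M) (18 * α)‖ ≤ 18 * α := by
    have : bs M - cutP (bs M) (18 * α)
        = cfc (fun t : ℝ => t - max (t - 18 * α) 0) (bs M) := by
      rw [cfc_sub (fun t : ℝ => t) _ (bs M) (by fun_prop) (by fun_prop), cfc_id' ℝ (bs M), cutP]
    rw [this]
    refine norm_cfc_le (by positivity) fun t ht => ?_
    have h0 : 0 ≤ t := spectrum_nonneg_of_nonneg (hbspos M) ht
    rw [Real.norm_eq_abs, abs_le]
    rcases le_total (t - 18 * α) 0 with h | h
    · rw [max_eq_right h]; constructor <;> linarith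
    · rw [max_eq_left h]; constructor <;> linarith
  refine ⟨M, S9.core B hBc (18 * α) (22 * α) (by positivity) (by linarith) (bs' n) f
    (cutP (bs M) (18 * α)) y (hbsB' n)
    (S9.mem_cfc B hBc (hbsB M) _ (by fun_prop) (by simp [hα0.le])) hyB (hbspos' n) hf0
    (S9.sa_cfc _ _) hfb ?_⟩
  have e : f - y * cutP (bs M) (18 * α) * star y
      = (x - y) * (as M * star x) + y * as M * star (x - y) + y * (as M - bs M) * star y
        + y * (bs M - cutP (bs M) (18 * α)) * star y := by
    rw [hf, star_sub]; noncomm_ring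
  rw [e]
  have t1 : ‖(x - y) * (as M * star x)‖ ≤ α := by
    have h1 : ‖as M * star x‖ ≤ 1 := (norm_mul_le _ _).trans
      (mul_le_one₀ (has1 M) (norm_nonneg _) (by rwa [norm_star]))
    refine (norm_mul_le _ _).trans ?_
    exact (mul_le_of_le_one_right (norm_nonneg _) h1).trans hxy.le
  have t2 : ‖y * as M * star (x - y)‖ ≤ α := by
    have h1 : ‖y * as M‖ ≤ 1 := (norm_mul_le _ _).trans (mul_le_one₀ hy1 (norm_nonneg _) (has1 M))
    refine (norm_mul_le _ _).trans ?_
    rw [norm_star]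
    exact (mul_le_of_le_one_left (norm_nonneg _) h1).trans hxy.le
  have t3 : ‖y * (as M - bs M) * star y‖ ≤ 2 * α := (S9.norm_conj_le' y _ hy1).trans (hclose M).le
  have t4 : ‖y * (bs M - cutP (bs M) (18 * α)) * star y‖ ≤ 18 * α :=
    (S9.norm_conj_le' y _ hy1).trans hcut
  refine (norm_add_le _ _).trans ?_
  have := norm_add₃_le (a := (x - y) * (as M * star x)) (b := y * as M * star (x - y))
    (c := y * (as M - bs M) * star y)
  linarith
end
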